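/- Assume additionally that f is convex, and let γ ∈ (0, 1/L]. Then for all θ, ϑ, ξ ∈ Θ: −2γ (F(Prox_γ(θ)) − F(ϑ)) ≥ ‖Prox_γ(θ) − ϑ‖² + 2 ⟨Prox_γ(θ) − ϑ, ξ − γ∇f(ξ) − θ⟩ − ‖ϑ − ξ‖², as an inequality in (−∞, +∞] (the left-hand side being +∞ when F(ϑ) = +∞). -/

import Mathlib

open Filter MeasureTheory Finset
open scoped InnerProductSpace Topology

noncomputable section

variable {E : Type*} [NormedAddCommGroup E] [InnerProductSpace ℝ E]

/-- Convexity of an `EReal`-valued function `g` (codomain `(-∞, +∞]`). -/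
def ERealConvexOn (g : E → EReal) : Prop :=
  ∀ x y : E, ∀ a b : ℝ, 0 ≤ a → 0 ≤ b → a + b = 1 →
    g (a • x + b • y) ≤ (a : EReal) * g x + (b : EReal) * g y

/-- `p` minimizes `v ↦ g v + ‖v - θ‖² / (2γ)`. -/
def IsProxPt (g : E → EReal) (γ : ℝ) (θ p : E) : Prop :=
  ∀ v : E, g p + ((‖p - θ‖ ^ 2 / (2 * γ) : ℝ) : EReal)
      ≤ g v + ((‖v - θ‖ ^ 2 / (2 * γ) : ℝ) : EReal)

/-- Subdifferential of an `EReal`-valued convex function at `θ`. -/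
def subdiff (g : E → EReal) (θ : E) : Set E :=
  {u : E | ∀ v : E, g θ + ((⟪u, v - θ⟫_ℝ : ℝ) : EReal) ≤ g v}

/-- The set `𝓛 = {θ ∈ Dom g : 0 ∈ ∇f(θ) + ∂g(θ)}`. -/
def statPoints (f' : E → E) (g : E → EReal) : Set E :=
  {θ : E | g θ ≠ ⊤ ∧ -f' θ ∈ subdiff g θ}

/-- `F = f + g`, with values in `(-∞, +∞]`. -/
def Fval (f : E → ℝ) (g : E → EReal) (θ : E) : EReal := (f θ : EReal) + g θ

/-- The real value of `F = f + g` (used at points of the domain of `g`). -/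
def Freal (f : E → ℝ) (g : E → EReal) (θ : E) : ℝ := f θ + (g θ).toReal

/-- The proximal gradient map `T_γ(θ) = Prox_γ(θ - γ ∇f(θ))`. -/
def Tmap (prox : ℝ → E → E) (f' : E → E) (γ : ℝ) (θ : E) : E :=
  prox γ (θ - γ • f' θ)

variable [CompleteSpace E]

/-- Standing assumptions: `g` is convex, lower semicontinuous, proper, with values in
`(-∞, +∞]`; `f` is differentiable with `L`-Lipschitz gradient `f'`; and `prox γ θ`
is the unique minimizer of `v ↦ g v + ‖v - θ‖²/(2γ)` for every `γ > 0`. -/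
structure ProxSetting (f : E → ℝ) (f' : E → E) (g : E → EReal) (L : ℝ)
    (prox : ℝ → E → E) : Prop where
  g_ne_bot : ∀ x, g x ≠ ⊥
  g_ne_top : ∃ x, g x ≠ ⊤
  g_lsc : LowerSemicontinuous g
  g_conv : ERealConvexOn g
  f_grad : ∀ x, HasGradientAt f (f' x) x
  L_pos : 0 < L
  lip : ∀ x y, ‖f' x - f' y‖ ≤ L * ‖x - y‖
  prox_spec : ∀ γ : ℝ, 0 < γ → ∀ θ, IsProxPt g γ θ (prox γ θ)
  prox_unique : ∀ γ : ℝ, 0 < γ → ∀ θ p, IsProxPt g γ θ p → p = prox γ θ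

end

theorem aux_descent {E : Type*} [NormedAddCommGroup E] [InnerProductSpace ℝ E] [CompleteSpace E]
    (f : E → ℝ) (f' : E → E) (L : ℝ) (hg : ∀ x, HasGradientAt f (f' x) x)
    (lip : ∀ x y, ‖f' x - f' y‖ ≤ L * ‖x - y‖) (x d : E) :
    f (x + d) ≤ f x + ⟪f' x, d⟫_ℝ + L / 2 * ‖d‖ ^ 2 := by
  have hd : ∀ t : ℝ, HasDerivAt (fun t : ℝ => f (x + t • d)) (⟪f' (x + t • d), d⟫_ℝ) t := by
    intro t
    have h1 : HasDerivAt (fun t : ℝ => x + t • d) d t := by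
      simpa using ((hasDerivAt_id t).smul_const d).const_add x
    have h2 := (hg (x + t • d)).hasFDerivAt.comp_hasDerivAt t h1
    simp at h2
    exact h2
  have hh : ∀ t : ℝ, HasDerivAt
      (fun t : ℝ => f (x + t • d) - t * ⟪f' x, d⟫_ℝ - t ^ 2 * (L / 2 * ‖d‖ ^ 2))
      (⟪f' (x + t • d), d⟫_ℝ - ⟪f' x, d⟫_ℝ - 2 * t * (L / 2 * ‖d‖ ^ 2)) t := by
    intro t
    have h1 := ((hd t).sub ((hasDerivAt_id t).mul_const (⟪f' x, d⟫_ℝ))).sub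
      ((hasDerivAt_pow 2 t).mul_const (L / 2 * ‖d‖ ^ 2))
    refine HasDerivAt.congr_deriv h1 ?_
    simp
  have hanti := antitoneOn_of_deriv_nonpos (convex_Icc (0:ℝ) 1)
    (fun t _ => (hh t).continuousAt.continuousWithinAt)
    (fun t _ => (hh t).differentiableAt.differentiableWithinAt)
    (by
      intro t ht
      rw [interior_Icc] at ht
      rw [(hh t).deriv]
      have h1 : ⟪f' (x + t • d) - f' x, d⟫_ℝ ≤ ‖f' (x + t • d) - f' x‖ * ‖d‖ :=
        real_inner_le_norm _ _
      have h2 := lip (x + t • d) x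
      rw [add_sub_cancel_left, norm_smul, Real.norm_eq_abs, abs_of_pos ht.1] at h2
      rw [inner_sub_left] at h1
      have h3 := mul_le_mul_of_nonneg_right h2 (norm_nonneg d)
      nlinarith)
  have := hanti (Set.left_mem_Icc.2 zero_le_one) (Set.right_mem_Icc.2 zero_le_one) zero_le_one
  simp at this
  linarith

theorem aux_convex {E : Type*} [NormedAddCommGroup E] [InnerProductSpace ℝ E] [CompleteSpace E]
    (f : E → ℝ) (f' : E → E) (hg : ∀ x, HasGradientAt f (f' x) x)
    (hf : ConvexOn ℝ Set.univ f) (x d : E) :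
    f x + ⟪f' x, d⟫_ℝ ≤ f (x + d) := by
  have hd : HasDerivAt (fun t : ℝ => f (x + t • d)) (⟪f' x, d⟫_ℝ) 0 := by
    have h1 : HasDerivAt (fun t : ℝ => x + t • d) d 0 := by
      simpa using ((hasDerivAt_id (0:ℝ)).smul_const d).const_add x
    have h2 := (hg (x + (0:ℝ) • d)).hasFDerivAt.comp_hasDerivAt (0:ℝ) h1
    simp at h2
    exact h2
  have hc : ConvexOn ℝ Set.univ (fun t : ℝ => f (x + t • d)) := by
    refine ⟨convex_univ, fun s _ t _ a b ha hb hab => ?_⟩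
    have := hf.2 (Set.mem_univ (x + s • d)) (Set.mem_univ (x + t • d)) ha hb hab
    convert this using 2
    have : x = a • x + b • x := by rw [← add_smul, hab, one_smul]
    nth_rewrite 1 [this]
    simp only [smul_add, add_smul, smul_eq_mul, mul_smul]
    abel
  have := hc.le_slope_of_hasDerivAt (Set.mem_univ 0) (Set.mem_univ 1) zero_lt_one hd
  simp [slope] at this
  linarith

theorem aux_lim (a b : ℝ) (h : ∀ t : ℝ, 0 < t → t < 1 → a ≤ t * b) : a ≤ 0 := by
  have h1 : Tendsto (fun t : ℝ => t * b) (𝓝[>] 0) (𝓝 0) := by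
    have : Tendsto (fun t : ℝ => t * b) (𝓝 0) (𝓝 (0 * b)) := by
      exact (continuous_id.mul continuous_const).tendsto 0
    rw [zero_mul] at this
    exact this.mono_left nhdsWithin_le_nhds
  refine ge_of_tendsto h1 ?_
  filter_upwards [Ioo_mem_nhdsGT (zero_lt_one (α := ℝ))] with t ht
  exact h t ht.1 ht.2

/-- **Lemma 6.2, Eq. (6.3)** (convex case). -/
theorem stmt14
    {E : Type*} [NormedAddCommGroup E] [InnerProductSpace ℝ E] [FiniteDimensional ℝ E]
    (f : E → ℝ) (f' : E → E) (g : E → EReal) (L : ℝ) (prox : ℝ → E → E)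
    (hs : ProxSetting f f' g L prox)
    (hfconv : ConvexOn ℝ Set.univ f)
    (γ : ℝ) (hγ0 : 0 < γ) (hγL : γ ≤ 1 / L) :
    ∀ θ ϑ ξ : E,
      ((‖prox γ θ - ϑ‖ ^ 2 + 2 * ⟪prox γ θ - ϑ, ξ - γ • f' ξ - θ⟫_ℝ -
          ‖ϑ - ξ‖ ^ 2 : ℝ) : EReal) ≤
        ((-2 * γ : ℝ) : EReal) * (Fval f g (prox γ θ) - Fval f g ϑ) := by
  intro θ ϑ ξ
  have hsp := hs.prox_spec γ hγ0 θ
  generalize prox γ θ = p at hsp ⊢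
  have hp : g p ≠ ⊤ := by
    intro hp
    obtain ⟨x, hx⟩ := hs.g_ne_top
    have := hsp x
    rw [hp, EReal.top_add_coe, top_le_iff] at this
    lift g x to ℝ using ⟨hx, hs.g_ne_bot x⟩ with r
    exact EReal.coe_ne_top _ (by rw [EReal.coe_add]; exact this)
  obtain ⟨u, hu⟩ : ∃ u : ℝ, (u : EReal) = g p := ⟨_, EReal.coe_toReal hp (hs.g_ne_bot p)⟩
  unfold Fval
  by_cases hϑ : g ϑ = ⊤
  · rw [hϑ, ← hu, EReal.coe_add_top, ← EReal.coe_add, EReal.sub_top, EReal.coe_mul_bot_of_neg (by linarith)]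
    exact le_top
  obtain ⟨w, hw⟩ : ∃ w : ℝ, (w : EReal) = g ϑ := ⟨_, EReal.coe_toReal hϑ (hs.g_ne_bot ϑ)⟩
  rw [← hu, ← hw, ← EReal.coe_add, ← EReal.coe_add, ← EReal.coe_sub, ← EReal.coe_mul,
    EReal.coe_le_coe_iff]
  have key : 2 * γ * (u - w) - 2 * ⟪p - θ, ϑ - p⟫_ℝ ≤ 0 := by
    refine aux_lim _ (‖ϑ - p‖ ^ 2) fun t ht0 ht1 => ?_
    have h1 := hsp ((1 - t) • p + t • ϑ)
    have h2 := h1.trans (add_le_add_left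
      (hs.g_conv p ϑ (1 - t) t (by linarith) ht0.le (by ring)) _)
    rw [← hu, ← hw] at h2
    have h3 : u + ‖p - θ‖ ^ 2 / (2 * γ) ≤
      (1 - t) * u + t * w + ‖(1 - t) • p + t • ϑ - θ‖ ^ 2 / (2 * γ) := by exact_mod_cast h2
    have e : (1 - t) • p + t • ϑ - θ = (p - θ) + t • (ϑ - p) := by module
    rw [e, norm_add_sq_real, inner_smul_right, norm_smul, Real.norm_eq_abs, abs_of_pos ht0] at h3
    have h4 := mul_le_mul_of_nonneg_left h3 (by positivity : 0 ≤ 2 * γ)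
    field_simp at h4
    have h5 : t * (2 * γ * (u - w) - 2 * ⟪p - θ, ϑ - p⟫_ℝ) ≤ t * (t * ‖ϑ - p‖ ^ 2) := by
      linarith
    exact le_of_mul_le_mul_left h5 ht0
  have hd := aux_descent f f' L hs.f_grad hs.lip ξ (p - ξ)
  have hc := aux_convex f f' hs.f_grad hfconv ξ (ϑ - ξ)
  rw [add_sub_cancel] at hd hc
  have hL : γ * L ≤ 1 := by rwa [le_div_iff₀ hs.L_pos] at hγL
  have h6 : 2 * γ * (f p - f ϑ) ≤ 2 * γ * (⟪f' ξ, p - ξ⟫_ℝ - ⟪f' ξ, ϑ - ξ⟫_ℝ + L / 2 * ‖p - ξ‖ ^ 2) :=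
    mul_le_mul_of_nonneg_left (by linarith) (by positivity)
  have h7 : γ * L * ‖p - ξ‖ ^ 2 ≤ 1 * ‖p - ξ‖ ^ 2 := mul_le_mul_of_nonneg_right hL (sq_nonneg _)
  have e1 : ⟪f' ξ, p - ξ⟫_ℝ - ⟪f' ξ, ϑ - ξ⟫_ℝ = ⟪p - ϑ, f' ξ⟫_ℝ := by
    rw [← inner_sub_right, real_inner_comm]; congr 1; abel
  have e2 : ϑ - ξ = (p - ξ) - (p - ϑ) := by abel
  have e3 : ξ - γ • f' ξ - θ = (p - θ) - (p - ξ) - γ • f' ξ := by abel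
  have e4 : ⟪p - θ, ϑ - p⟫_ℝ = - ⟪p - ϑ, p - θ⟫_ℝ := by
    rw [← inner_neg_left, real_inner_comm]; congr 1; abel
  rw [e1] at h6
  rw [e4] at key
  rw [e2, e3, norm_sub_sq_real (p - ξ), inner_sub_right, inner_sub_right, inner_smul_right,
    real_inner_comm (p - ϑ) (p - ξ)]
  linarith
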